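/- For every ε > 0 there is C > 0 such that for all t ∈ ℝ and all v : ℤ → ℂ with ‖v‖_{H^{1/2}} < ∞: ‖N(v)(t) + R(v)‖_{H^{−1/2−ε}} ≤ C ‖v‖³_{H^{1/2}}. -/

import Mathlib

open scoped ENNReal

/-- Japanese bracket `⟨k⟩ = 1 + |k|`. -/
noncomputable def jb (k : ℤ) : ℝ := 1 + |(k : ℝ)|

/-- `‖f‖_{H^s} = (∑_k ⟨k⟩^{2s} |f k|²)^{1/2}`, valued in `[0,∞]`. -/
noncomputable def hnorm (s : ℝ) (f : ℤ → ℂ) : ℝ≥0∞ :=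
  (∑' k : ℤ, ENNReal.ofReal (jb k ^ (2 * s) * ‖f k‖ ^ 2)) ^ (1 / 2 : ℝ)

/-- `Φ(k̄) = k³ − k₁³ − k₂³ − k₃³` with `k = k₁ + k₂ + k₃`. -/
def Phi (k₁ k₂ k₃ : ℤ) : ℤ := (k₁ + k₂ + k₃) ^ 3 - k₁ ^ 3 - k₂ ^ 3 - k₃ ^ 3

/-- Summand of the non-resonant part, parametrized by `(k₁, k₂)` with `k₃ = k - k₁ - k₂`. -/
noncomputable def ntermF (v : ℤ → ℂ) (t : ℝ) (k : ℤ) (p : ℤ × ℤ) : ℂ :=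
  if Phi p.1 p.2 (k - p.1 - p.2) ≠ 0 then
    (k : ℂ) * Complex.exp (Complex.I * (t : ℂ) * ((Phi p.1 p.2 (k - p.1 - p.2) : ℤ) : ℂ)) *
      v p.1 * v p.2 * v (k - p.1 - p.2)
  else 0

/-- Non-resonant part `N(v)(t)_k`. -/
noncomputable def Nonres (v : ℤ → ℂ) (t : ℝ) (k : ℤ) : ℂ :=
  Complex.I / 3 * ∑' p : ℤ × ℤ, ntermF v t k p

/-- Resonant part `R(v)_k = -i k |v_k|² v_k`. -/
noncomputable def Res (v : ℤ → ℂ) (k : ℤ) : ℂ :=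
  -Complex.I * (k : ℂ) * (‖v k‖ : ℂ) ^ 2 * v k

open MeasureTheory in
/-- Cauchy-Schwarz for sums of extended nonnegative reals. -/
theorem ENNReal.sq_tsum_le_of_sq_le_mul {ι : Type*} {x f g : ι → ℝ≥0∞}
    (h : ∀ i, x i ^ 2 ≤ f i * g i) : (∑' i, x i) ^ 2 ≤ (∑' i, f i) * ∑' i, g i := by
  let _ : MeasurableSpace ι := ⊤
  have key := ENNReal.lintegral_mul_norm_pow_le (μ := Measure.count) (f := f) (g := g)
    (measurable_from_top.aemeasurable) (measurable_from_top.aemeasurable)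
    (p := 1 / 2) (q := 1 / 2) (by norm_num) (by norm_num) (by norm_num)
  simp only [lintegral_count] at key
  have hx : ∀ i, x i ≤ f i ^ (1 / 2 : ℝ) * g i ^ (1 / 2 : ℝ) := fun i => by
    rw [← ENNReal.mul_rpow_of_nonneg _ _ (by norm_num)]
    calc x i = (x i ^ 2) ^ (1 / 2 : ℝ) := by
          rw [← ENNReal.rpow_natCast, ← ENNReal.rpow_mul]; norm_num
      _ ≤ _ := ENNReal.rpow_le_rpow (h i) (by norm_num)
  calc (∑' i, x i) ^ 2
      ≤ ((∑' i, f i) ^ (1 / 2 : ℝ) * (∑' i, g i) ^ (1 / 2 : ℝ)) ^ 2 := by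
        gcongr
        exact (ENNReal.tsum_le_tsum hx).trans key
    _ = _ := by
        rw [mul_pow, ← ENNReal.rpow_natCast, ← ENNReal.rpow_natCast, ← ENNReal.rpow_mul,
          ← ENNReal.rpow_mul]
        norm_num

theorem ENNReal.sq_add_le (a b : ℝ≥0∞) : (a + b) ^ 2 ≤ 4 * (a ^ 2 + b ^ 2) := by
  have h : a + b ≤ 2 * max a b := by
    rw [two_mul]; exact add_le_add (le_max_left _ _) (le_max_right _ _)
  calc (a + b) ^ 2 ≤ (2 * max a b) ^ 2 := by gcongr
    _ = 4 * (max a b) ^ 2 := by rw [mul_pow]; norm_num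
    _ ≤ 4 * (a ^ 2 + b ^ 2) := by
        gcongr
        rcases max_choice a b with h | h <;> rw [h]
        · exact le_self_add
        · exact le_add_self

theorem one_le_jb (k : ℤ) : 1 ≤ jb k := by
  unfold jb; linarith [abs_nonneg (k : ℝ)]

theorem jb_pos (k : ℤ) : 0 < jb k := one_pos.trans_le (one_le_jb k)

theorem jb_le_add (k p q : ℤ) : jb k ≤ jb p + jb q + jb (k - p - q) := by
  unfold jb
  have h := abs_add_three (p : ℝ) q ((k - p - q : ℤ) : ℝ)
  have e : (p : ℝ) + q + ((k - p - q : ℤ) : ℝ) = k := by push_cast; ring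
  rw [e] at h
  linarith

theorem summable_jb_rpow {b : ℝ} (hb : 1 < b) : Summable fun k : ℤ => jb k ^ (-b) := by
  refine Summable.of_norm_bounded_eventually (Real.summable_abs_int_rpow hb) ?_
  filter_upwards [(Set.finite_singleton (0 : ℤ)).compl_mem_cofinite] with k hk
  have hk : (0 : ℝ) < |(k : ℝ)| := abs_pos.2 (by exact_mod_cast hk)
  rw [Real.norm_of_nonneg (Real.rpow_nonneg (jb_pos k).le _)]
  exact Real.rpow_le_rpow_of_nonpos hk (by unfold jb; linarith) (by linarith)

theorem rpow_mul_inv_le_of_max {n x y z δ : ℝ} (hn : 1 ≤ n) (hy : 1 ≤ y) (hz : 1 ≤ z)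
    (hyx : y ≤ x) (hzx : z ≤ x) (hs : n ≤ x + y + z) (hδ : 0 < δ) (hδ' : δ ≤ 1 / 2) :
    n ^ (1 - 2 * δ) * (x * y * z)⁻¹ ≤ 3 * (y ^ (-(1 + δ)) * z ^ (-(1 + δ))) := by
  have hx0 : 0 < x := by linarith
  have hy0 : 0 < y := by linarith
  have hz0 : 0 < z := by linarith
  have h1 : n ^ (1 - 2 * δ) ≤ 3 * (x * x ^ (-δ) * x ^ (-δ)) := by
    calc n ^ (1 - 2 * δ) ≤ (3 * x) ^ (1 - 2 * δ) :=
          Real.rpow_le_rpow (by linarith) (by linarith) (by linarith)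
      _ = 3 ^ (1 - 2 * δ) * x ^ (1 - 2 * δ) := Real.mul_rpow (by norm_num) hx0.le
      _ ≤ 3 ^ (1 : ℝ) * x ^ (1 - 2 * δ) := by
          gcongr
          · norm_num
          · linarith
      _ = _ := by
          rw [Real.rpow_one, show 1 - 2 * δ = 1 + -δ + -δ by ring, Real.rpow_add hx0,
            Real.rpow_add hx0, Real.rpow_one]
  have h2 : x ^ (-δ) ≤ y ^ (-δ) := Real.rpow_le_rpow_of_nonpos hy0 hyx (by linarith)
  have h3 : x ^ (-δ) ≤ z ^ (-δ) := Real.rpow_le_rpow_of_nonpos hz0 hzx (by linarith)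
  calc n ^ (1 - 2 * δ) * (x * y * z)⁻¹ ≤ 3 * (x * y ^ (-δ) * z ^ (-δ)) * (x * y * z)⁻¹ := by
        gcongr
        refine h1.trans ?_
        gcongr
    _ = _ := by
        rw [show -(1 + δ) = -δ - 1 by ring, Real.rpow_sub_one hy0.ne', Real.rpow_sub_one hz0.ne']
        field_simp

theorem rpow_mul_inv_le {n x y z δ : ℝ} (hn : 1 ≤ n) (hx : 1 ≤ x) (hy : 1 ≤ y) (hz : 1 ≤ z)
    (hs : n ≤ x + y + z) (hδ : 0 < δ) (hδ' : δ ≤ 1 / 2) :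
    n ^ (1 - 2 * δ) * (x * y * z)⁻¹ ≤
      3 * (y ^ (-(1 + δ)) * z ^ (-(1 + δ)) + x ^ (-(1 + δ)) * z ^ (-(1 + δ)) +
        x ^ (-(1 + δ)) * y ^ (-(1 + δ))) := by
  have p1 : 0 < x ^ (-(1 + δ)) := Real.rpow_pos_of_pos (by linarith) _
  have p2 : 0 < y ^ (-(1 + δ)) := Real.rpow_pos_of_pos (by linarith) _
  have p3 : 0 < z ^ (-(1 + δ)) := Real.rpow_pos_of_pos (by linarith) _
  have q1 := mul_pos p2 p3
  have q2 := mul_pos p1 p3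
  have q3 := mul_pos p1 p2
  by_cases hyx : y ≤ x
  · by_cases hzx : z ≤ x
    · have := rpow_mul_inv_le_of_max hn hy hz hyx hzx hs hδ hδ'
      linarith
    · have := rpow_mul_inv_le_of_max (x := z) (y := x) (z := y) hn hx hy (by linarith)
        (by linarith) (by linarith) hδ hδ'
      rw [show z * x * y = x * y * z by ring] at this
      linarith
  · by_cases hzy : z ≤ y
    · have := rpow_mul_inv_le_of_max (x := y) (y := x) (z := z) hn hx hz (by linarith)
        hzy (by linarith) hδ hδ'
      rw [show y * x * z = x * y * z by ring] at this
      linarith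
    · have := rpow_mul_inv_le_of_max (x := z) (y := x) (z := y) hn hx hy (by linarith)
        (by linarith) (by linarith) hδ hδ'
      rw [show z * x * y = x * y * z by ring] at this
      linarith

/-- Summing over pairs does not depend on which two of the three frequencies are chosen. -/
theorem tsum_pair_third (f g : ℤ → ℝ≥0∞) (k : ℤ) :
    ∑' p : ℤ × ℤ, f p.1 * g (k - p.1 - p.2) = (∑' i, f i) * ∑' i, g i := by
  rw [ENNReal.tsum_prod', ← ENNReal.tsum_mul_right]
  refine tsum_congr fun i => ?_
  dsimp only
  rw [ENNReal.tsum_mul_left]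
  congr 1
  exact (Equiv.subLeft (k - i)).tsum_eq g

theorem tsum_pair_third' (f g : ℤ → ℝ≥0∞) (k : ℤ) :
    ∑' p : ℤ × ℤ, f p.2 * g (k - p.1 - p.2) = (∑' i, f i) * ∑' i, g i := by
  rw [← tsum_pair_third f g k, ← (Equiv.prodComm ℤ ℤ).tsum_eq]
  refine tsum_congr fun p => ?_
  simp only [Equiv.prodComm_apply, Prod.fst_swap, Prod.snd_swap]
  rw [sub_right_comm]

theorem tsum_pair (f g : ℤ → ℝ≥0∞) :
    ∑' p : ℤ × ℤ, f p.1 * g p.2 = (∑' i, f i) * ∑' i, g i := by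
  rw [ENNReal.tsum_prod', ← ENNReal.tsum_mul_right]
  refine tsum_congr fun i => ?_
  dsimp only
  rw [ENNReal.tsum_mul_left]

theorem tsum_trilinear (B : ℤ → ℝ≥0∞) :
    ∑' k : ℤ, ∑' p : ℤ × ℤ, B p.1 * B p.2 * B (k - p.1 - p.2) = (∑' i, B i) ^ 3 := by
  rw [ENNReal.tsum_comm]
  have h : ∀ p : ℤ × ℤ, ∑' k : ℤ, B p.1 * B p.2 * B (k - p.1 - p.2) =
      B p.1 * B p.2 * ∑' i, B i := fun p => by
    rw [ENNReal.tsum_mul_left]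
    congr 1
    simp_rw [sub_sub]
    exact (Equiv.subRight (p.1 + p.2)).tsum_eq B
  simp_rw [h]
  rw [ENNReal.tsum_mul_right, tsum_pair]
  ring

theorem tsum_pow_three_le (B : ℤ → ℝ≥0∞) : ∑' k, B k ^ 3 ≤ (∑' k, B k) ^ 3 := by
  calc ∑' k, B k ^ 3 ≤ ∑' k, (∑' i, B i) ^ 2 * B k := by
        refine ENNReal.tsum_le_tsum fun k => ?_
        rw [pow_succ]
        gcongr
        exact ENNReal.le_tsum k
    _ = _ := by rw [ENNReal.tsum_mul_left, ← pow_succ]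

/-- The weight arising in the Cauchy-Schwarz argument is bounded uniformly in `k`. -/
theorem exists_weight_bound {ε : ℝ} (hε : 0 < ε) : ∃ M : ℝ≥0∞, M ≠ ⊤ ∧ ∀ k : ℤ,
    ENNReal.ofReal (jb k ^ (2 * (-(1 / 2) - ε)) * jb k ^ 2) *
      ∑' p : ℤ × ℤ, ENNReal.ofReal ((jb p.1 * jb p.2 * jb (k - p.1 - p.2))⁻¹) ≤ M := by
  obtain ⟨δ, hδ, hδ', hδε⟩ : ∃ δ : ℝ, 0 < δ ∧ δ ≤ 1 / 2 ∧ δ ≤ ε :=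
    ⟨min ε (1 / 2), by positivity, min_le_right _ _, min_le_left _ _⟩
  set h : ℤ → ℝ≥0∞ := fun k => ENNReal.ofReal (jb k ^ (-(1 + δ))) with hh
  have hS : ∑' k, h k ≠ ⊤ := by
    rw [hh, ← ENNReal.ofReal_tsum_of_nonneg (fun k => Real.rpow_nonneg (jb_pos k).le _)
      (summable_jb_rpow (by linarith))]
    exact ENNReal.ofReal_ne_top
  refine ⟨3 * ((∑' k, h k) * ∑' k, h k + (∑' k, h k) * ∑' k, h k + (∑' k, h k) * ∑' k, h k),
    by finiteness, fun k => ?_⟩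
  have hterm : ∀ p : ℤ × ℤ, ENNReal.ofReal (jb k ^ (2 * (-(1 / 2) - ε)) * jb k ^ 2) *
      ENNReal.ofReal ((jb p.1 * jb p.2 * jb (k - p.1 - p.2))⁻¹) ≤
      3 * (h p.2 * h (k - p.1 - p.2) + h p.1 * h (k - p.1 - p.2) + h p.1 * h p.2) := fun p => by
    have nn : ∀ k : ℤ, 0 ≤ jb k ^ (-(1 + δ)) := fun k => Real.rpow_nonneg (jb_pos k).le _
    have key := rpow_mul_inv_le (one_le_jb k) (one_le_jb p.1) (one_le_jb p.2)
      (one_le_jb (k - p.1 - p.2)) (jb_le_add k p.1 p.2) hδ hδ'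
    have hk := jb_pos k
    have h1 := jb_pos p.1
    have h2 := jb_pos p.2
    have h3 := jb_pos (k - p.1 - p.2)
    have hexp : jb k ^ (2 * (-(1 / 2) - ε)) * jb k ^ 2 ≤ jb k ^ (1 - 2 * δ) := by
      rw [← Real.rpow_natCast, ← Real.rpow_add hk]
      exact Real.rpow_le_rpow_of_exponent_le (one_le_jb k) (by push_cast; linarith)
    rw [← ENNReal.ofReal_mul (by positivity)]
    refine (ENNReal.ofReal_le_ofReal ((mul_le_mul_of_nonneg_right hexp
      (by positivity)).trans key)).trans (le_of_eq ?_)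
    rw [ENNReal.ofReal_mul (by norm_num), ENNReal.ofReal_add (by positivity) (by positivity),
      ENNReal.ofReal_add (by positivity) (by positivity), ENNReal.ofReal_mul (nn _),
      ENNReal.ofReal_mul (nn _), ENNReal.ofReal_mul (nn _)]
    norm_num [hh]
  rw [← ENNReal.tsum_mul_left]
  refine (ENNReal.tsum_le_tsum hterm).trans (le_of_eq ?_)
  rw [ENNReal.tsum_mul_left, ENNReal.tsum_add, ENNReal.tsum_add, tsum_pair_third',
    tsum_pair_third, tsum_pair]

theorem enorm_intCast_le_jb (k : ℤ) : ‖(k : ℂ)‖ₑ ≤ ENNReal.ofReal (jb k) := by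
  rw [← ofReal_norm]
  refine ENNReal.ofReal_le_ofReal ?_
  rw [Complex.norm_intCast]
  unfold jb
  linarith

theorem enorm_ntermF_le (v : ℤ → ℂ) (t : ℝ) (k : ℤ) (p : ℤ × ℤ) :
    ‖ntermF v t k p‖ₑ ≤
      ENNReal.ofReal (jb k) * (‖v p.1‖ₑ * ‖v p.2‖ₑ * ‖v (k - p.1 - p.2)‖ₑ) := by
  unfold ntermF
  split_ifs
  · have he : ‖Complex.exp (Complex.I * (t : ℂ) *
        ((Phi p.1 p.2 (k - p.1 - p.2) : ℤ) : ℂ))‖ₑ = 1 := by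
      rw [← ofReal_norm, Complex.norm_exp]
      simp
    rw [enorm_mul, enorm_mul, enorm_mul, enorm_mul, he, mul_one, mul_assoc, mul_assoc,
      mul_assoc]
    gcongr
    exact enorm_intCast_le_jb k
  · simp

theorem enorm_Nonres_le (v : ℤ → ℂ) (t : ℝ) (k : ℤ) :
    ‖Nonres v t k‖ₑ ≤ ENNReal.ofReal (jb k) *
      ∑' p : ℤ × ℤ, ‖v p.1‖ₑ * ‖v p.2‖ₑ * ‖v (k - p.1 - p.2)‖ₑ := by
  have h3 : ‖Complex.I / 3‖ₑ ≤ 1 := by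
    rw [← ofReal_norm, ENNReal.ofReal_le_one]
    norm_num
  unfold Nonres
  rw [enorm_mul, ← ENNReal.tsum_mul_left]
  refine (mul_le_of_le_one_left' h3).trans (enorm_tsum_le_tsum_enorm.trans ?_)
  exact ENNReal.tsum_le_tsum (enorm_ntermF_le v t k)

theorem enorm_Res_le (v : ℤ → ℂ) (k : ℤ) :
    ‖Res v k‖ₑ ≤ ENNReal.ofReal (jb k) * ‖v k‖ₑ ^ 3 := by
  unfold Res
  have e : ‖(‖v k‖ : ℂ)‖ₑ = ‖v k‖ₑ := by
    rw [← ofReal_norm, ← ofReal_norm]; simp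
  rw [enorm_mul, enorm_mul, enorm_mul, enorm_pow, e, mul_assoc, ← pow_succ]
  gcongr
  have hI : ‖-Complex.I‖ₑ = 1 := by rw [← ofReal_norm]; simp
  rw [hI, one_mul]
  exact enorm_intCast_le_jb k

theorem ofReal_mul_norm_sq {a : ℝ} (ha : 0 ≤ a) (z : ℂ) :
    ENNReal.ofReal (a * ‖z‖ ^ 2) = ENNReal.ofReal a * ‖z‖ₑ ^ 2 := by
  rw [ENNReal.ofReal_mul ha, ENNReal.ofReal_pow (norm_nonneg _), ofReal_norm]

theorem sq_tsum_trilinear_le (v : ℤ → ℂ) (k : ℤ) :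
    (∑' p : ℤ × ℤ, ‖v p.1‖ₑ * ‖v p.2‖ₑ * ‖v (k - p.1 - p.2)‖ₑ) ^ 2 ≤
      (∑' p : ℤ × ℤ, ENNReal.ofReal ((jb p.1 * jb p.2 * jb (k - p.1 - p.2))⁻¹)) *
      ∑' p : ℤ × ℤ, (ENNReal.ofReal (jb p.1) * ‖v p.1‖ₑ ^ 2) *
        (ENNReal.ofReal (jb p.2) * ‖v p.2‖ₑ ^ 2) *
        (ENNReal.ofReal (jb (k - p.1 - p.2)) * ‖v (k - p.1 - p.2)‖ₑ ^ 2) := by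
  refine ENNReal.sq_tsum_le_of_sq_le_mul fun p => le_of_eq ?_
  have h1 := jb_pos p.1
  have h2 := jb_pos p.2
  have h3 := jb_pos (k - p.1 - p.2)
  have hc : ENNReal.ofReal ((jb p.1 * jb p.2 * jb (k - p.1 - p.2))⁻¹) *
      (ENNReal.ofReal (jb p.1) * ENNReal.ofReal (jb p.2) *
        ENNReal.ofReal (jb (k - p.1 - p.2))) = 1 := by
    rw [← ENNReal.ofReal_mul h1.le, ← ENNReal.ofReal_mul (by positivity),
      ← ENNReal.ofReal_mul (by positivity), inv_mul_cancel₀ (by positivity), ENNReal.ofReal_one]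
  calc _ = 1 * (‖v p.1‖ₑ * ‖v p.2‖ₑ * ‖v (k - p.1 - p.2)‖ₑ) ^ 2 := (one_mul _).symm
    _ = _ := by rw [← hc]; ring

theorem weighted_sq_nonlinearity_le {ε : ℝ} (hε : 0 < ε) {M : ℝ≥0∞} (v : ℤ → ℂ) (t : ℝ) (k : ℤ)
    (hM : ENNReal.ofReal (jb k ^ (2 * (-(1 / 2) - ε)) * jb k ^ 2) *
      ∑' p : ℤ × ℤ, ENNReal.ofReal ((jb p.1 * jb p.2 * jb (k - p.1 - p.2))⁻¹) ≤ M) :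
    ENNReal.ofReal (jb k ^ (2 * (-(1 / 2) - ε)) * ‖Nonres v t k + Res v k‖ ^ 2) ≤
      4 * (M * ∑' p : ℤ × ℤ, (ENNReal.ofReal (jb p.1) * ‖v p.1‖ₑ ^ 2) *
        (ENNReal.ofReal (jb p.2) * ‖v p.2‖ₑ ^ 2) *
        (ENNReal.ofReal (jb (k - p.1 - p.2)) * ‖v (k - p.1 - p.2)‖ₑ ^ 2) +
        (ENNReal.ofReal (jb k) * ‖v k‖ₑ ^ 2) ^ 3) := by
  have hw : 0 ≤ jb k ^ (2 * (-(1 / 2) - ε)) := Real.rpow_nonneg (jb_pos k).le _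
  have hw1 : ENNReal.ofReal (jb k ^ (2 * (-(1 / 2) - ε))) ≤ 1 :=
    ENNReal.ofReal_le_one.2 (Real.rpow_le_one_of_one_le_of_nonpos (one_le_jb k) (by linarith))
  have hJ : 1 ≤ ENNReal.ofReal (jb k) := ENNReal.one_le_ofReal.2 (one_le_jb k)
  rw [ofReal_mul_norm_sq hw]
  rw [ENNReal.ofReal_mul hw, ENNReal.ofReal_pow (jb_pos k).le] at hM
  set w := ENNReal.ofReal (jb k ^ (2 * (-(1 / 2) - ε)))
  set J := ENNReal.ofReal (jb k)
  calc w * ‖Nonres v t k + Res v k‖ₑ ^ 2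
      ≤ w * (4 * (‖Nonres v t k‖ₑ ^ 2 + ‖Res v k‖ₑ ^ 2)) := by
        gcongr
        refine le_trans ?_ (ENNReal.sq_add_le _ _)
        gcongr
        exact enorm_add_le _ _
    _ = 4 * (w * ‖Nonres v t k‖ₑ ^ 2 + w * ‖Res v k‖ₑ ^ 2) := by ring
    _ ≤ _ := by
        refine mul_le_mul' le_rfl (add_le_add ?_ ?_)
        · refine le_trans ?_ (mul_le_mul' hM le_rfl)
          rw [mul_assoc w, mul_assoc w, mul_assoc (J ^ 2)]
          gcongr
          refine (pow_le_pow_left' (enorm_Nonres_le v t k) 2).trans ?_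
          rw [mul_pow]
          gcongr
          exact sq_tsum_trilinear_le v k
        · refine (mul_le_of_le_one_left' hw1).trans
            ((pow_le_pow_left' (enorm_Res_le v k) 2).trans ?_)
          rw [mul_pow, mul_pow, ← pow_mul, ← pow_mul]
          gcongr
          norm_num

theorem hnorm_half (v : ℤ → ℂ) :
    hnorm (1 / 2) v = (∑' k, ENNReal.ofReal (jb k) * ‖v k‖ₑ ^ 2) ^ (1 / 2 : ℝ) := by
  unfold hnorm
  congr 1
  refine tsum_congr fun k => ?_
  rw [show (2 * (1 / 2) : ℝ) = 1 by norm_num, Real.rpow_one, ofReal_mul_norm_sq (jb_pos k).le]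

/-- `‖N(v)(t) + R(v)‖_{H^{-1/2-ε}} ≲ ‖v‖³_{H^{1/2}}`. -/
theorem nonlinearity_rough_bound (ε : ℝ) (hε : 0 < ε) :
    ∃ C > (0 : ℝ), ∀ t : ℝ, ∀ v : ℤ → ℂ, hnorm (1 / 2) v < ⊤ →
      hnorm (-(1 / 2) - ε) (fun k => Nonres v t k + Res v k) ≤
        ENNReal.ofReal C * hnorm (1 / 2) v ^ 3 := by
  obtain ⟨M, hM, hMk⟩ := exists_weight_bound hε
  have hK : 4 * (M + 1) ≠ ⊤ := by finiteness
  have hK' : (4 * (M + 1)) ^ (1 / 2 : ℝ) ≠ ⊤ := ENNReal.rpow_ne_top_of_nonneg (by norm_num) hK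
  have hK0 : (4 * (M + 1)) ^ (1 / 2 : ℝ) ≠ 0 := by
    rw [Ne, ENNReal.rpow_eq_zero_iff_of_pos (by norm_num)]
    simp
  refine ⟨((4 * (M + 1)) ^ (1 / 2 : ℝ)).toReal, ENNReal.toReal_pos hK0 hK', fun t v _ => ?_⟩
  rw [ENNReal.ofReal_toReal hK', hnorm_half]
  set T := ∑' k, ENNReal.ofReal (jb k) * ‖v k‖ₑ ^ 2
  have hT : (T ^ (1 / 2 : ℝ)) ^ 3 = (T ^ 3) ^ (1 / 2 : ℝ) := by
    rw [← ENNReal.rpow_natCast, ← ENNReal.rpow_natCast, ← ENNReal.rpow_mul, ← ENNReal.rpow_mul,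
      mul_comm]
  rw [hT, ← ENNReal.mul_rpow_of_nonneg _ _ (by norm_num)]
  unfold hnorm
  refine ENNReal.rpow_le_rpow ?_ (by norm_num)
  refine (ENNReal.tsum_le_tsum fun k => weighted_sq_nonlinearity_le hε v t k (hMk k)).trans ?_
  rw [ENNReal.tsum_mul_left, ENNReal.tsum_add, ENNReal.tsum_mul_left,
    tsum_trilinear fun k => ENNReal.ofReal (jb k) * ‖v k‖ₑ ^ 2, mul_assoc, add_mul, one_mul]
  gcongr
  exact tsum_pow_three_le _
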